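/- Let E ⊆ ℤ and 0 ≤ α ≤ 1. If H_α(E) > 0, then there exists a regular subset E' ⊆ E with D(E') = α. In particular, for every 0 ≤ α < D(E) there exists a regular subset E' ⊆ E with D(E') = α. -/

import Mathlib

open Filter MeasureTheory
open scoped ENNReal

noncomputable section

/-- The filter of intervals `(M, N]` of `ℤ` as the length `N - M` tends to infinity.
An interval is encoded by the pair `(M, N)`. -/
def intervalFilter : Filter (ℤ × ℤ) :=
  Filter.comap (fun p : ℤ × ℤ => p.2 - p.1) Filter.atTop

/-- The number of elements of `E` in the interval `(M, N]`. -/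
def icount (E : Set ℤ) (M N : ℤ) : ℕ := (E ∩ Set.Ioc M N).ncard

/-- The counting dimension of `E ⊆ ℤ`:
`D(E) = limsup_{|I| → ∞} log |E ∩ I| / log |I|`. -/
def countingDim (E : Set ℤ) : ℝ :=
  Filter.limsup
    (fun p : ℤ × ℤ => Real.log (icount E p.1 p.2) / Real.log ((p.2 - p.1 : ℤ) : ℝ))
    intervalFilter

/-- The counting `α`-measure of `E ⊆ ℤ`:
`H_α(E) = limsup_{|I| → ∞} |E ∩ I| / |I|^α`, with values in `[0, ∞]`. -/
def countingMeasure (α : ℝ) (E : Set ℤ) : ℝ≥0∞ :=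
  Filter.limsup
    (fun p : ℤ × ℤ =>
      ENNReal.ofReal ((icount E p.1 p.2 : ℝ) / ((p.2 - p.1 : ℤ) : ℝ) ^ α))
    intervalFilter

/-- The upper-Banach density of `E ⊆ ℤ`:
`d*(E) = limsup_{|I| → ∞} |E ∩ I| / |I|`. -/
def upperBanach (E : Set ℤ) : ℝ :=
  Filter.limsup
    (fun p : ℤ × ℤ => (icount E p.1 p.2 : ℝ) / ((p.2 - p.1 : ℤ) : ℝ))
    intervalFilter

/-- `E ⊆ ℤ` is regular if `0 < H_{D(E)}(E) < ∞`. -/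
def Regular (E : Set ℤ) : Prop :=
  0 < countingMeasure (countingDim E) E ∧ countingMeasure (countingDim E) E < ⊤

/-- Two (regular) sets `E, F ⊆ ℤ` are compatible if there are sequences of intervals
`I_n = (a n, b n]`, `J_n = (c n, d n]` with increasing lengths, `|I_n| ≍ |J_n|`,
`|E ∩ I_n| ≫ |I_n|^{D(E)}` and `|F ∩ J_n| ≫ |J_n|^{D(F)}`. -/
def Compatible (E F : Set ℤ) : Prop :=
  ∃ a b c d : ℕ → ℤ,
    (∀ n, a n < b n) ∧ (∀ n, c n < d n) ∧
    StrictMono (fun n => b n - a n) ∧ StrictMono (fun n => d n - c n) ∧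
    (∃ C : ℝ, 0 < C ∧ ∀ n,
      ((b n - a n : ℤ) : ℝ) ≤ C * ((d n - c n : ℤ) : ℝ) ∧
      ((d n - c n : ℤ) : ℝ) ≤ C * ((b n - a n : ℤ) : ℝ)) ∧
    (∃ c₁ : ℝ, 0 < c₁ ∧ ∀ n,
      c₁ * ((b n - a n : ℤ) : ℝ) ^ countingDim E ≤ (icount E (a n) (b n) : ℝ)) ∧
    (∃ c₂ : ℝ, 0 < c₂ ∧ ∀ n,
      c₂ * ((d n - c n : ℤ) : ℝ) ^ countingDim F ≤ (icount F (c n) (d n) : ℝ))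

/-- The arithmetic sum `E + ⌊λ F⌋ = {a + ⌊λ b⌋ : a ∈ E, b ∈ F}`. -/
def sumFloor (E F : Set ℤ) (l : ℝ) : Set ℤ :=
  {n : ℤ | ∃ a ∈ E, ∃ b ∈ F, n = a + ⌊l * (b : ℝ)⌋}

theorem icount_mono {E F : Set ℤ} (h : E ⊆ F) (M N : ℤ) : icount E M N ≤ icount F M N :=
  Set.ncard_le_ncard (Set.inter_subset_inter_left _ h) ((Set.finite_Ioc M N).inter_of_right F)

theorem icount_le_length (E : Set ℤ) {M N : ℤ} (h : M ≤ N) :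
    (icount E M N : ℝ) ≤ ((N - M : ℤ) : ℝ) := by
  have h1 : icount E M N ≤ (Set.Ioc M N).ncard :=
    Set.ncard_le_ncard Set.inter_subset_right (Set.finite_Ioc M N)
  have h2 : (Set.Ioc M N).ncard = (N - M).toNat := by
    rw [← Finset.coe_Ioc, Set.ncard_coe_finset, Int.card_Ioc]
  have h3 : (icount E M N : ℤ) ≤ N - M := by omega
  exact_mod_cast h3

theorem icount_insert_le (F : Set ℤ) (a M N : ℤ) :
    icount (insert a F) M N ≤ icount F M N + 1 := by
  unfold icount
  refine (Set.ncard_le_ncard (t := insert a (F ∩ Set.Ioc M N)) ?_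
    (((Set.finite_Ioc M N).inter_of_right F).insert a)).trans (Set.ncard_insert_le _ _)
  rintro x ⟨rfl | hx, hx'⟩
  · exact Set.mem_insert _ _
  · exact Set.mem_insert_of_mem _ ⟨hx, hx'⟩

theorem icount_insert_of_notMem (F : Set ℤ) {a M N : ℤ} (ha : a ∉ Set.Ioc M N) :
    icount (insert a F) M N = icount F M N := by
  unfold icount
  rw [Set.insert_inter_of_notMem ha]

instance intervalFilter_neBot : intervalFilter.NeBot :=
  Filter.NeBot.comap_of_surj atTop_neBot fun z => ⟨(0, z), by simp⟩

theorem tendsto_length_intervalFilter :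
    Tendsto (fun p : ℤ × ℤ => ((p.2 - p.1 : ℤ) : ℝ)) intervalFilter atTop :=
  tendsto_intCast_atTop_atTop.comp tendsto_comap

theorem tendsto_log_length_intervalFilter :
    Tendsto (fun p : ℤ × ℤ => Real.log ((p.2 - p.1 : ℤ) : ℝ)) intervalFilter atTop :=
  Real.tendsto_log_atTop.comp tendsto_length_intervalFilter

theorem log_icount_ratio_nonneg (E : Set ℤ) (p : ℤ × ℤ) :
    0 ≤ Real.log (icount E p.1 p.2) / Real.log ((p.2 - p.1 : ℤ) : ℝ) := by
  refine div_nonneg (Real.log_natCast_nonneg _) ?_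
  rw [← Real.log_abs, ← Int.cast_abs, Int.abs_eq_natAbs, Int.cast_natCast]
  exact Real.log_natCast_nonneg _

theorem isBoundedUnder_log_icount_ratio (E : Set ℤ) :
    IsBoundedUnder (· ≤ ·) intervalFilter
      (fun p : ℤ × ℤ => Real.log (icount E p.1 p.2) / Real.log ((p.2 - p.1 : ℤ) : ℝ)) := by
  refine ⟨1, eventually_map.2 ?_⟩
  filter_upwards [tendsto_length_intervalFilter.eventually_gt_atTop 1] with p hp
  rw [div_le_one (Real.log_pos hp)]
  have hlen : p.1 ≤ p.2 := by
    have : (1 : ℤ) < p.2 - p.1 := by exact_mod_cast hp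
    omega
  rcases Nat.eq_zero_or_pos (icount E p.1 p.2) with h0 | h0
  · simpa [h0] using (Real.log_pos hp).le
  · exact Real.log_le_log (by exact_mod_cast h0) (icount_le_length E hlen)

theorem countingDim_le_of_countingMeasure_lt_top {E : Set ℤ} {α : ℝ} (hα : 0 ≤ α)
    (h : countingMeasure α E < ⊤) : countingDim E ≤ α := by
  obtain ⟨b, hb, hbt⟩ := exists_between h
  refine le_of_forall_pos_le_add fun ε hε => ?_
  refine limsup_le_of_le
    ((isBoundedUnder_of ⟨0, log_icount_ratio_nonneg E⟩ :
      IsBoundedUnder (· ≥ ·) _ _).isCoboundedUnder_le) ?_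
  filter_upwards [eventually_lt_of_limsup_lt hb,
    tendsto_length_intervalFilter.eventually_gt_atTop 1,
    tendsto_log_length_intervalFilter.eventually_ge_atTop (|Real.log b.toReal| / ε)]
    with p hp h1 h2
  have hlog := Real.log_pos h1
  have hL : (0 : ℝ) < ((p.2 - p.1 : ℤ) : ℝ) := by linarith
  rw [div_le_iff₀ hlog]
  rw [div_le_iff₀ hε] at h2
  rcases Nat.eq_zero_or_pos (icount E p.1 p.2) with h0 | h0
  · rw [h0, Nat.cast_zero, Real.log_zero]
    positivity
  · have h0' : (0 : ℝ) < icount E p.1 p.2 := by exact_mod_cast h0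
    have hpow : (0 : ℝ) < ((p.2 - p.1 : ℤ) : ℝ) ^ α := Real.rpow_pos_of_pos hL α
    have h3 : (icount E p.1 p.2 : ℝ) / ((p.2 - p.1 : ℤ) : ℝ) ^ α < b.toReal :=
      (ENNReal.ofReal_lt_iff_lt_toReal (by positivity) hbt.ne).1 hp
    have hbpos : 0 < b.toReal := lt_of_le_of_lt (by positivity) h3
    rw [div_lt_iff₀ hpow] at h3
    have h4 := Real.log_le_log h0' h3.le
    rw [Real.log_mul hbpos.ne' hpow.ne', Real.log_rpow hL] at h4
    linarith [le_abs_self (Real.log b.toReal)]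

theorem le_countingDim_of_countingMeasure_pos {E : Set ℤ} {α : ℝ}
    (h : 0 < countingMeasure α E) : α ≤ countingDim E := by
  obtain ⟨b, hb0, hb⟩ := exists_between h
  have hbt : b ≠ ⊤ := (lt_of_lt_of_le hb le_top).ne
  have hbpos : 0 < b.toReal := ENNReal.toReal_pos hb0.ne' hbt
  refine le_of_forall_sub_le fun ε hε => ?_
  refine le_limsup_of_frequently_le ?_ (isBoundedUnder_log_icount_ratio E)
  refine ((frequently_lt_of_lt_limsup (by isBoundedDefault) hb).and_eventually
    ((tendsto_length_intervalFilter.eventually_gt_atTop 1).and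
    (tendsto_log_length_intervalFilter.eventually_ge_atTop (|Real.log b.toReal| / ε)))).mono ?_
  rintro p ⟨hp, h1, h2⟩
  have hL : (0 : ℝ) < ((p.2 - p.1 : ℤ) : ℝ) := by linarith
  rw [le_div_iff₀ (Real.log_pos h1)]
  rw [div_le_iff₀ hε] at h2
  have hpow : (0 : ℝ) < ((p.2 - p.1 : ℤ) : ℝ) ^ α := Real.rpow_pos_of_pos hL α
  rw [ENNReal.lt_ofReal_iff_toReal_lt hbt, lt_div_iff₀ hpow] at hp
  have h4 := Real.log_le_log (by positivity) hp.le
  rw [Real.log_mul hbpos.ne' hpow.ne', Real.log_rpow hL] at h4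
  linarith [neg_abs_le (Real.log b.toReal)]

theorem countingDim_eq_of_countingMeasure {E : Set ℤ} {α : ℝ} (hα : 0 ≤ α)
    (h0 : 0 < countingMeasure α E) (h1 : countingMeasure α E < ⊤) : countingDim E = α :=
  (countingDim_le_of_countingMeasure_lt_top hα h1).antisymm
    (le_countingDim_of_countingMeasure_pos h0)

/-- Every set of integers contains a maximal subset with at most `2 |I| ^ α` elements in each
interval `I`. -/
theorem exists_maximal_subset_icount_le (E : Set ℤ) (α : ℝ) :
    ∃ F : Set ℤ, Maximal (fun F : Set ℤ => F ⊆ E ∧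
      ∀ M N : ℤ, M < N → (icount F M N : ℝ) ≤ 2 * ((N - M : ℤ) : ℝ) ^ α) F := by
  refine zorn_subset {F : Set ℤ | F ⊆ E ∧
      ∀ M N : ℤ, M < N → (icount F M N : ℝ) ≤ 2 * ((N - M : ℤ) : ℝ) ^ α} fun c hc hchain => ?_
  rcases c.eq_empty_or_nonempty with rfl | hne
  · refine ⟨∅, ⟨Set.empty_subset _, fun M N hMN => ?_⟩, by simp⟩
    have : (0 : ℝ) ≤ ((N - M : ℤ) : ℝ) := by exact_mod_cast (sub_pos.2 hMN).le
    simp only [icount, Set.empty_inter, Set.ncard_empty, Nat.cast_zero]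
    positivity
  · refine ⟨⋃₀ c, ⟨Set.sUnion_subset fun s hs => (hc hs).1, fun M N hMN => ?_⟩,
      fun s hs => Set.subset_sUnion_of_mem hs⟩
    obtain ⟨s, hs, hsub⟩ := hchain.directedOn.exists_mem_subset_of_finite_of_subset_sUnion hne
      ((Set.finite_Ioc M N).inter_of_right (⋃₀ c)) Set.inter_subset_left
    refine le_trans ?_ ((hc hs).2 M N hMN)
    exact_mod_cast Set.ncard_le_ncard (Set.subset_inter hsub Set.inter_subset_right)
      ((Set.finite_Ioc M N).inter_of_right s)

/-- If every point of `E` is within distance `L` of a point of `F`, then the number of points of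
`E` in an interval is controlled by the number of points of `F` in its `L`-neighbourhood. -/
theorem icount_le_of_forall_exists_near {E F : Set ℤ} {L : ℕ}
    (h : ∀ a ∈ E, ∃ b ∈ F, |a - b| ≤ L) (M N : ℤ) :
    icount E M N ≤ icount F (M - L) (N + L) * (2 * L + 1) := by
  classical
  have hfin : (F ∩ Set.Ioc (M - L) (N + L)).Finite := (Set.finite_Ioc _ _).inter_of_right F
  have hsub : E ∩ Set.Ioc M N ⊆
      ((hfin.toFinset.biUnion fun b => Finset.Icc (b - L) (b + L) : Finset ℤ) : Set ℤ) := by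
    rintro a ⟨haE, ha⟩
    obtain ⟨b, hb, hab⟩ := h a haE
    rw [abs_le] at hab
    simp only [Finset.coe_biUnion, Set.mem_iUnion, Set.Finite.mem_toFinset, Finset.coe_Icc,
      Set.mem_Icc, Finset.mem_coe, exists_prop, Set.mem_inter_iff, Set.mem_Ioc] at ha ⊢
    exact ⟨b, ⟨hb, by omega, by omega⟩, by omega, by omega⟩
  unfold icount
  refine (Set.ncard_le_ncard hsub (Finset.finite_toSet _)).trans ?_
  rw [Set.ncard_coe_finset, Set.ncard_eq_toFinset_card _ hfin]
  refine Finset.card_biUnion_le_card_mul _ _ _ fun b _ => ?_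
  rw [Int.card_Icc]
  omega

theorem countingMeasure_le_of_forall_icount_le {F : Set ℤ} {α C : ℝ}
    (h : ∀ M N : ℤ, M < N → (icount F M N : ℝ) ≤ C * ((N - M : ℤ) : ℝ) ^ α) :
    countingMeasure α F ≤ ENNReal.ofReal C := by
  refine limsup_le_of_le (by isBoundedDefault) ?_
  filter_upwards [tendsto_length_intervalFilter.eventually_gt_atTop 0] with p hp
  refine ENNReal.ofReal_le_ofReal ((div_le_iff₀ (Real.rpow_pos_of_pos hp α)).2 (h _ _ ?_))
  exact sub_pos.1 (by exact_mod_cast hp)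

/-- A point outside a maximal subset lies in an interval that is almost saturated. -/
theorem exists_saturated_interval {E F : Set ℤ} {α : ℝ} (hα : 0 ≤ α)
    (hF : Maximal (fun F : Set ℤ => F ⊆ E ∧
      ∀ M N : ℤ, M < N → (icount F M N : ℝ) ≤ 2 * ((N - M : ℤ) : ℝ) ^ α) F)
    {a : ℤ} (haE : a ∈ E) (haF : a ∉ F) :
    ∃ M N : ℤ, a ∈ Set.Ioc M N ∧ ((N - M : ℤ) : ℝ) ^ α < icount F M N := by
  by_contra! hcon
  refine haF (hF.2 (y := insert a F) ⟨Set.insert_subset haE hF.1.1, fun M N hMN => ?_⟩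
    (Set.subset_insert a F) (Set.mem_insert a F))
  by_cases ha : a ∈ Set.Ioc M N
  · have h1 : (1 : ℝ) ≤ ((N - M : ℤ) : ℝ) ^ α :=
      Real.one_le_rpow (by exact_mod_cast sub_pos.2 hMN) hα
    have h2 : (icount (insert a F) M N : ℝ) ≤ icount F M N + 1 := by
      exact_mod_cast icount_insert_le F a M N
    linarith [hcon M N ha]
  · rw [icount_insert_of_notMem F ha]
    exact hF.1.2 M N hMN

theorem countingMeasure_pos_of_maximal {E F : Set ℤ} {α : ℝ} (hα : 0 ≤ α)
    (hE : countingMeasure α E = ⊤)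
    (hF : Maximal (fun F : Set ℤ => F ⊆ E ∧
      ∀ M N : ℤ, M < N → (icount F M N : ℝ) ≤ 2 * ((N - M : ℤ) : ℝ) ^ α) F) :
    0 < countingMeasure α F := by
  by_contra hpos
  have hlt : countingMeasure α F < 1 := lt_of_le_of_lt (not_lt.1 hpos) zero_lt_one
  have hev := eventually_lt_of_limsup_lt hlt
  rw [intervalFilter, eventually_comap, eventually_atTop] at hev
  obtain ⟨z, hz⟩ := hev
  have hnear : ∀ a ∈ E, ∃ b ∈ F, |a - b| ≤ (z.toNat : ℕ) := by
    intro a haE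
    by_cases haF : a ∈ F
    · exact ⟨a, haF, by simp⟩
    obtain ⟨M, N, haI, hsat⟩ := exists_saturated_interval hα hF haE haF
    have hMN : M < N := haI.1.trans_le haI.2
    have hL : (0 : ℝ) < ((N - M : ℤ) : ℝ) := by exact_mod_cast sub_pos.2 hMN
    have hpow : (0 : ℝ) < ((N - M : ℤ) : ℝ) ^ α := Real.rpow_pos_of_pos hL α
    have hlen : N - M < z := by
      by_contra! hge
      have h1 := hz (N - M) hge (M, N) rfl
      rw [ENNReal.ofReal_lt_one, div_lt_one hpow] at h1
      exact lt_asymm hsat h1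
    have hne : (F ∩ Set.Ioc M N).Nonempty := by
      by_contra hempty
      rw [Set.not_nonempty_iff_eq_empty] at hempty
      rw [icount, hempty, Set.ncard_empty, Nat.cast_zero] at hsat
      exact lt_asymm hsat hpow
    obtain ⟨b, hbF, hb⟩ := hne
    refine ⟨b, hbF, ?_⟩
    simp only [Set.mem_Ioc] at haI hb
    rw [abs_le]
    omega
  set L := z.toNat
  refine (countingMeasure_le_of_forall_icount_le (F := E) (α := α)
    (C := 2 * (2 * L + 1 : ℝ) ^ α * (2 * L + 1)) fun M N hMN => ?_).not_gt
    (hE ▸ ENNReal.ofReal_lt_top)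
  have h1 : (icount E M N : ℝ) ≤ icount F (M - L) (N + L) * (2 * L + 1) := by
    exact_mod_cast icount_le_of_forall_exists_near hnear M N
  have h2 := hF.1.2 (M - L) (N + L) (by omega)
  have hL : (1 : ℝ) ≤ ((N - M : ℤ) : ℝ) := by exact_mod_cast sub_pos.2 hMN
  have h3 : ((N + L - (M - L) : ℤ) : ℝ) ^ α ≤ (2 * L + 1 : ℝ) ^ α * ((N - M : ℤ) : ℝ) ^ α := by
    rw [← Real.mul_rpow (by positivity) (by linarith)]
    refine Real.rpow_le_rpow (by exact_mod_cast (by omega : (0 : ℤ) ≤ N + L - (M - L))) ?_ hα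
    push_cast at hL ⊢
    nlinarith [(Nat.cast_nonneg L : (0 : ℝ) ≤ L)]
  calc (icount E M N : ℝ) ≤ icount F (M - L) (N + L) * (2 * L + 1) := h1
    _ ≤ (2 * ((2 * L + 1 : ℝ) ^ α * ((N - M : ℤ) : ℝ) ^ α)) * (2 * L + 1) := by
      gcongr
      exact h2.trans (by gcongr)
    _ = _ := by ring

theorem exists_regular_subset {E : Set ℤ} {α : ℝ} (hα : 0 ≤ α)
    (h : 0 < countingMeasure α E) :
    ∃ E' : Set ℤ, E' ⊆ E ∧ Regular E' ∧ countingDim E' = α := by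
  suffices ∃ F ⊆ E, 0 < countingMeasure α F ∧ countingMeasure α F < ⊤ by
    obtain ⟨F, hFE, h0, h1⟩ := this
    have hdim := countingDim_eq_of_countingMeasure hα h0 h1
    exact ⟨F, hFE, by rw [Regular, hdim]; exact ⟨h0, h1⟩, hdim⟩
  by_cases hE : countingMeasure α E = ⊤
  · obtain ⟨F, hF⟩ := exists_maximal_subset_icount_le E α
    exact ⟨F, hF.1.1, countingMeasure_pos_of_maximal hα hE hF,
      (countingMeasure_le_of_forall_icount_le hF.1.2).trans_lt ENNReal.ofReal_lt_top⟩
  · exact ⟨E, subset_rfl, h, lt_top_iff_ne_top.2 hE⟩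

/-- **Proposition 4.1.** If `0 ≤ α ≤ 1` and `H_α(E) > 0`, then `E` contains a regular
subset `E'` with `D(E') = α`; in particular, for every `0 ≤ α < D(E)` there is a
regular subset `E' ⊆ E` with `D(E') = α`. -/
theorem regular_subset_of_positive_measure (E : Set ℤ) :
    (∀ α : ℝ, 0 ≤ α → α ≤ 1 → 0 < countingMeasure α E →
      ∃ E' : Set ℤ, E' ⊆ E ∧ Regular E' ∧ countingDim E' = α) ∧
    (∀ α : ℝ, 0 ≤ α → α < countingDim E →
      ∃ E' : Set ℤ, E' ⊆ E ∧ Regular E' ∧ countingDim E' = α) := by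
  refine ⟨fun α hα _ h => exists_regular_subset hα h, fun α hα h => ?_⟩
  refine exists_regular_subset hα (pos_iff_ne_zero.2 fun h0 => h.not_ge ?_)
  exact countingDim_le_of_countingMeasure_lt_top hα (h0 ▸ ENNReal.zero_lt_top)
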